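/- arXiv:1605.09434 — 3 statements merged into one kernel-verified Lean document; each statement's English description precedes it below -/
import Mathlib

section
/- Let R be a reduced ring (not necessarily commutative) and let e, f ∈ R be idempotent elements. If there exists u ∈ R such that u*(f*e) = e and (f*e)*u = f, then e = f. -/
/-- In a ring without nonzero elements of square zero, every idempotent is central. -/
theorem IsIdempotentElem.commute_of_sq_eq_zero {R : Type*} [Ring R]
    (hred : ∀ x : R, x ^ 2 = 0 → x = 0) {e : R} (he : IsIdempotentElem e) (r : R) :
    Commute e r := by
  have hl : e * r * (1 - e) = 0 := hred _ <| by
    rw [sq, show e * r * (1 - e) * (e * r * (1 - e)) =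
      e * r * ((1 - e) * e) * (r * (1 - e)) by simp only [mul_assoc],
      he.one_sub_mul_self, mul_zero, zero_mul]
  have hr : (1 - e) * r * e = 0 := hred _ <| by
    rw [sq, show (1 - e) * r * e * ((1 - e) * r * e) =
      (1 - e) * r * (e * (1 - e)) * (r * e) by simp only [mul_assoc],
      he.mul_one_sub_self, mul_zero, zero_mul]
  rw [mul_sub, mul_one, sub_eq_zero] at hl
  rw [sub_mul, sub_mul, one_mul, sub_eq_zero] at hr
  exact hl.trans hr.symm


/-- In a reduced (not necessarily commutative) ring, if `e` and `f` are idempotents and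
`f * e` is invertible "from `e` to `f`" (i.e. there is `u` with `u * (f * e) = e` and
`(f * e) * u = f`), then `e = f`. -/
theorem idempotents_eq_of_comp_isUnit {R : Type*} [Ring R]
    (hred : ∀ x : R, x ^ 2 = 0 → x = 0)
    (e f : R) (he : e ^ 2 = e) (hf : f ^ 2 = f)
    (u : R) (h1 : u * (f * e) = e) (h2 : (f * e) * u = f) :
    e = f := by
  have hc : e * f = f * e :=
    IsIdempotentElem.commute_of_sq_eq_zero hred ((sq e).symm.trans he) f
  rw [sq] at he hf
  calc e = u * (f * e) := h1.symm
    _ = u * (f * e) * f := by rw [mul_assoc, mul_assoc, hc, ← mul_assoc f f, hf]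
    _ = e * f := by rw [h1]
    _ = e * (f * e * u) := by rw [h2]
    _ = f * e * u := by rw [← hc, ← mul_assoc, ← mul_assoc, he]
    _ = f := h2
end

section
/- Let A be a (not necessarily commutative) ring, R ⊆ A a subring, I a finite set, and (e_i)_{i∈I} a family of idempotent elements of A that are pairwise orthogonal (e_i * e_j = 0 whenever i ≠ j) and satisfy Σ_{i∈I} e_i = 1. For a subset K ⊆ I write e_K := Σ_{i∈K} e_i (with e_∅ = 0). Assume that for every subset K ⊆ I with ∅ ≠ K ≠ I, none of the elements e_K, 2·e_K, 3·e_K lies in R. Then for all subsets S, T ⊆ I: if 2·e_S + e_T ∈ R, then S ∈ {∅, I} and T ∈ {∅, I}. -/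
open Finset

/-- Partial sums of a family of orthogonal idempotents multiply like indicator functions. -/
theorem sum_mul_sum_eq_sum_inter {A ι : Type*} [Ring A] [DecidableEq ι] {e : ι → A}
    (hidem : ∀ i, e i ^ 2 = e i) (horth : ∀ i j, i ≠ j → e i * e j = 0) (S T : Finset ι) :
    (∑ i ∈ S, e i) * (∑ i ∈ T, e i) = ∑ i ∈ S ∩ T, e i := by
  have hmul (i j : ι) : e i * e j = if i = j then e i else 0 := by
    split_ifs with h
    · rw [← h, ← sq, hidem]
    · exact horth i j h
  simp_rw [Finset.sum_mul_sum, hmul, Finset.sum_ite_eq, Finset.sum_ite_mem]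

/-- Ring-theoretic form of Lemma 4.4 ("liverpool"): given a complete system of pairwise
orthogonal idempotents `e i` in a ring `A` summing to `1`, and a subring `R` such that for
every proper nonempty subset `K` of the index set none of `e_K`, `2·e_K`, `3·e_K` lies in `R`,
then `2·e_S + e_T ∈ R` forces `S` and `T` to be `∅` or the whole index set. -/
theorem liverpool {A : Type*} [Ring A] (R : Subring A)
    {ι : Type*} [Fintype ι] [DecidableEq ι]
    (e : ι → A)
    (hidem : ∀ i, e i ^ 2 = e i)
    (horth : ∀ i j, i ≠ j → e i * e j = 0)
    (hsum : ∑ i, e i = 1)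
    (hK : ∀ K : Finset ι, K ≠ ∅ → K ≠ Finset.univ →
      (∑ i ∈ K, e i) ∉ R ∧ (2 : A) * (∑ i ∈ K, e i) ∉ R ∧ (3 : A) * (∑ i ∈ K, e i) ∉ R)
    (S T : Finset ι)
    (hST : (2 : A) * (∑ i ∈ S, e i) + (∑ i ∈ T, e i) ∈ R) :
    (S = ∅ ∨ S = Finset.univ) ∧ (T = ∅ ∨ T = Finset.univ) := by
  have hmul := sum_mul_sum_eq_sum_inter hidem horth
  have htriv (K : Finset ι)
      (h : (2 : A) * (∑ i ∈ K, e i) ∈ R ∨ (3 : A) * (∑ i ∈ K, e i) ∈ R) :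
      K = ∅ ∨ K = univ := by
    by_contra! hne
    obtain ⟨-, h2, h3⟩ := hK K hne.1.ne_empty hne.2
    exact h.elim h2 h3
  have hsdiff (K L : Finset ι) :
      ∑ i ∈ K \ L, e i = ∑ i ∈ K, e i - ∑ i ∈ K ∩ L, e i := by
    rw [eq_sub_iff_add_eq', sum_inter_add_sum_sdiff]
  have hss : (∑ i ∈ S, e i) * (∑ i ∈ S, e i) = ∑ i ∈ S, e i := by rw [hmul, inter_self]
  have htt : (∑ i ∈ T, e i) * (∑ i ∈ T, e i) = ∑ i ∈ T, e i := by rw [hmul, inter_self]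
  have hst := hmul S T
  have hts : (∑ i ∈ T, e i) * (∑ i ∈ S, e i) = ∑ i ∈ S ∩ T, e i := by rw [hmul, inter_comm]
  have hsw : (∑ i ∈ S, e i) * (∑ i ∈ S ∩ T, e i) = ∑ i ∈ S ∩ T, e i := by
    rw [hmul, ← inter_assoc, inter_self]
  have htw : (∑ i ∈ T, e i) * (∑ i ∈ S ∩ T, e i) = ∑ i ∈ S ∩ T, e i := by
    rw [hmul, inter_comm S, ← inter_assoc, inter_self]
  have hdiffST := hsdiff S T
  have hdiffTS := hsdiff T S
  rw [inter_comm T S] at hdiffTS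
  set s := ∑ i ∈ S, e i
  set t := ∑ i ∈ T, e i
  set w := ∑ i ∈ S ∩ T, e i
  have hsq : (2 * s + t) ^ 2 = 4 * s + 4 * w + t := by
    have h : (2 * s + t) ^ 2 = 4 * (s * s) + 2 * (s * t) + 2 * (t * s) + t * t := by
      noncomm_ring
    rw [h, hss, hst, hts, htt]
    noncomm_ring
  have hcube : (2 * s + t) ^ 3 = 8 * s + 18 * w + t := by
    rw [pow_succ', hsq]
    have h : (2 * s + t) * (4 * s + 4 * w + t) = 8 * (s * s) + 8 * (s * w) + 2 * (s * t)
        + 4 * (t * s) + 4 * (t * w) + t * t := by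
      noncomm_ring
    rw [h, hss, hsw, hst, hts, htw, htt]
    noncomm_ring
  -- The integer polynomials below take the values `(0, 0, 2, 0)`, `(0, 2, 0, 0)` and
  -- `(0, 3, 0, 3)` at `0, 1, 2, 3`.
  have hST' : S \ T = ∅ ∨ S \ T = univ := by
    refine htriv _ (.inl ?_)
    have h : 4 • (2 * s + t) ^ 2 - (2 * s + t) ^ 3 - 3 • (2 * s + t) ∈ R :=
      sub_mem (sub_mem (nsmul_mem (pow_mem hST 2) 4) (pow_mem hST 3)) (nsmul_mem hST 3)
    rw [hsq, hcube] at h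
    rw [hdiffST]
    convert h using 1
    noncomm_ring
  have hTS' : T \ S = ∅ ∨ T \ S = univ := by
    refine htriv _ (.inl ?_)
    have h : (2 * s + t) ^ 3 - 5 • (2 * s + t) ^ 2 + 6 • (2 * s + t) ∈ R :=
      add_mem (sub_mem (pow_mem hST 3) (nsmul_mem (pow_mem hST 2) 5)) (nsmul_mem hST 6)
    rw [hsq, hcube] at h
    rw [hdiffTS]
    convert h using 1
    noncomm_ring
  have hT : T = ∅ ∨ T = univ := by
    refine htriv _ (.inr ?_)
    have h : 2 • (2 * s + t) ^ 3 - 9 • (2 * s + t) ^ 2 + 10 • (2 * s + t) ∈ R :=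
      add_mem (sub_mem (nsmul_mem (pow_mem hST 3) 2) (nsmul_mem (pow_mem hST 2) 9))
        (nsmul_mem hST 10)
    rw [hsq, hcube] at h
    convert h using 1
    noncomm_ring
  refine ⟨?_, hT⟩
  rcases hT with rfl | rfl
  · simpa using hST'
  · rw [← compl_eq_univ_sdiff, compl_eq_empty_iff, compl_eq_univ_iff] at hTS'
    exact hTS'.symm
end

section
/- Let k be a field of characteristic different from 2, let c ∈ k satisfy c^3 = 4, and let x, y ∈ k with x ≠ 0 and x^6 + y^6 = −1. Then ((x^6 − 1)/(2·x^3))^2 = (y^4/(c·x^2))^3 − 1. -/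
/-- The map `φ₂(x,y) = (y⁴/(∛4·x²), (x⁶−1)/(2x³))` sends the affine Fermat sextic
`x⁶ + y⁶ = −1` into the affine elliptic curve `v² = u³ − 1`. -/
theorem phi2_maps_fermat_to_elliptic {k : Type*} [Field k]
    (h2 : (2 : k) ≠ 0) (c : k) (hc : c ^ 3 = 4)
    (x y : k) (hx : x ≠ 0) (h : x ^ 6 + y ^ 6 = -1) :
    ((x ^ 6 - 1) / (2 * x ^ 3)) ^ 2 = (y ^ 4 / (c * x ^ 2)) ^ 3 - 1 := by
  have h4 : (4 : k) ≠ 0 := by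
    rw [show (4 : k) = 2 ^ 2 by norm_num]
    exact pow_ne_zero 2 h2
  have hy : y ^ 6 = -1 - x ^ 6 := eq_sub_of_add_eq' h
  have hu : (y ^ 4 / (c * x ^ 2)) ^ 3 = (-1 - x ^ 6) ^ 2 / (4 * x ^ 6) := by
    rw [div_pow, mul_pow, hc, ← hy]
    ring
  have hv : ((x ^ 6 - 1) / (2 * x ^ 3)) ^ 2 = (x ^ 6 - 1) ^ 2 / (4 * x ^ 6) := by
    rw [div_pow, mul_pow]
    norm_num [← pow_mul]
  rw [hu, hv, div_sub_one (mul_ne_zero h4 (pow_ne_zero 6 hx))]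
  ring
end
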